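/- The Weierstrass-type function f(x) = σ(u - x) e^{ζ(u)x} / (σ(u)σ(x)) satisfies the addition formula f(x) f'(y) - f(y) f'(x) = (z(x) - z(y)) f(x + y), where z(x) = f''(x)/(2 f(x)) = ℘(x) + ℘(u)/2 (with λ = 1). -/

import Mathlib

open scoped BigOperators

/-- The period lattice generated by `ω₁`, `ω₂`. -/
noncomputable def wLattice (ω₁ ω₂ : ℂ) : AddSubgroup ℂ := AddSubgroup.closure {ω₁, ω₂}

/-- The nonzero lattice points. -/
noncomputable def wLatticeStar (ω₁ ω₂ : ℂ) : Type := {w : ℂ // w ∈ wLattice ω₁ ω₂ ∧ w ≠ 0}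

/-- The Weierstrass sigma function of the lattice. -/
noncomputable def wSigma (ω₁ ω₂ : ℂ) (z : ℂ) : ℂ :=
  z * ∏' w : wLatticeStar ω₁ ω₂,
    (1 - z / w.1) * Complex.exp (z / w.1 + z ^ 2 / (2 * w.1 ^ 2))

/-- The Weierstrass zeta function of the lattice. -/
noncomputable def wZeta (ω₁ ω₂ : ℂ) (z : ℂ) : ℂ :=
  z⁻¹ + ∑' w : wLatticeStar ω₁ ω₂, ((z - w.1)⁻¹ + (w.1)⁻¹ + z / w.1 ^ 2)

/-- The Weierstrass `℘`-function of the lattice. -/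
noncomputable def wP (ω₁ ω₂ : ℂ) (z : ℂ) : ℂ :=
  (z ^ 2)⁻¹ + ∑' w : wLatticeStar ω₁ ω₂, (((z - w.1) ^ 2)⁻¹ - (w.1 ^ 2)⁻¹)

/-- The Calogero-Moser function `f(x) = σ(u-x) e^{ζ(u) x} / (σ(u) σ(x))`. -/
noncomputable def cmF (ω₁ ω₂ u : ℂ) (x : ℂ) : ℂ :=
  wSigma ω₁ ω₂ (u - x) * Complex.exp (wZeta ω₁ ω₂ u * x) /
    (wSigma ω₁ ω₂ u * wSigma ω₁ ω₂ x)

open Filter Topology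

/-- The Weierstrass elementary factor of order two is `1 + O(t ^ 3)`. -/
lemma norm_one_sub_mul_exp_sub_one_le {t : ℂ} (ht : ‖t‖ ≤ 1 / 2) :
    ‖(1 - t) * Complex.exp (t + t ^ 2 / 2) - 1‖ ≤ 2 * ‖t‖ ^ 3 := by
  have hv : ‖t + t ^ 2 / 2‖ ≤ 5 / 4 * ‖t‖ := by
    refine (norm_add_le _ _).trans ?_
    simp only [norm_div, norm_pow, Complex.norm_ofNat]
    nlinarith [norm_nonneg t]
  have hb := Complex.exp_bound (x := t + t ^ 2 / 2) (by linarith) (n := 3) (by norm_num)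
  simp only [Finset.sum_range_succ, Finset.sum_range_zero] at hb
  norm_num [Nat.factorial] at hb
  set v := t + t ^ 2 / 2 with hvdef
  set r := Complex.exp v - (1 + v + v ^ 2 / 2) with hr
  have hr' : ‖r‖ ≤ 1 / 2 * ‖t‖ ^ 3 := by
    refine hb.trans ?_
    have : ‖v‖ ^ 3 ≤ (5 / 4 * ‖t‖) ^ 3 := by gcongr
    have h3 : 0 ≤ ‖t‖ ^ 3 := by positivity
    nlinarith
  have key : (1 - t) * Complex.exp v - 1
      = -(t ^ 3 * (1 / 2 + 3 / 8 * t + 1 / 8 * t ^ 2)) + (1 - t) * r := by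
    rw [hr, hvdef]; ring
  have h1 : ‖(1 / 2 + 3 / 8 * t + 1 / 8 * t ^ 2 : ℂ)‖ ≤ 1 := by
    refine (norm_add_le _ _).trans ((add_le_add_left (norm_add_le _ _) _).trans ?_)
    simp only [norm_div, norm_mul, norm_pow, Complex.norm_ofNat, norm_one]
    nlinarith [norm_nonneg t]
  have h2 : ‖1 - t‖ ≤ 3 / 2 := (norm_sub_le _ _).trans (by rw [norm_one]; linarith)
  rw [key]
  calc _ ≤ ‖t‖ ^ 3 * ‖(1 / 2 + 3 / 8 * t + 1 / 8 * t ^ 2 : ℂ)‖ + ‖1 - t‖ * ‖r‖ := by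
        refine (norm_add_le _ _).trans ?_
        rw [norm_neg, norm_mul, norm_mul, norm_pow]
    _ ≤ ‖t‖ ^ 3 * 1 + 3 / 2 * (1 / 2 * ‖t‖ ^ 3) := by gcongr
    _ ≤ _ := by nlinarith [pow_nonneg (norm_nonneg t) 3]

namespace PeriodPair

variable (L : PeriodPair)

lemma isPreconnected_compl_lattice : IsPreconnected (L.lattice : Set ℂ)ᶜ :=
  (Set.Countable.isConnected_compl_of_one_lt_rank (by simp)
    (countable_of_Lindelof_of_discrete (X := L.lattice))).2

lemma isOpen_compl_lattice : IsOpen (L.lattice : Set ℂ)ᶜ := L.isClosed_lattice.isOpen_compl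

lemma summable_norm_inv_pow_three : Summable fun l : L.lattice ↦ (‖l.1‖ ^ 3)⁻¹ := by
  have := ZLattice.summable_norm_rpow L.lattice (-3) (by simp; norm_num)
  refine this.congr fun l ↦ ?_
  rw [Real.rpow_neg (norm_nonneg _)]
  norm_cast

/-- The factor attached to a lattice point in the product for the sigma function. -/
noncomputable def sigmaFactor (l z : ℂ) : ℂ :=
  (1 - z / l) * Complex.exp (z / l + z ^ 2 / (2 * l ^ 2))

@[simp] lemma sigmaFactor_zero_left (z : ℂ) : sigmaFactor 0 z = 1 := by simp [sigmaFactor]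

@[simp] lemma sigmaFactor_zero_right (l : ℂ) : sigmaFactor l 0 = 1 := by simp [sigmaFactor]

lemma sigmaFactor_neg (l z : ℂ) : sigmaFactor (-l) (-z) = sigmaFactor l z := by
  simp [sigmaFactor]

@[fun_prop]
lemma differentiable_sigmaFactor (l : ℂ) : Differentiable ℂ (sigmaFactor l) := by
  unfold sigmaFactor
  fun_prop

lemma sigmaFactor_ne_zero {l z : ℂ} (h : z ≠ l) : sigmaFactor l z ≠ 0 := by
  rcases eq_or_ne l 0 with rfl | hl
  · simp
  · refine mul_ne_zero (fun h' ↦ h ?_) (Complex.exp_ne_zero _)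
    field_simp at h'
    linear_combination -h'

lemma logDeriv_sigmaFactor {l z : ℂ} (hl : l ≠ 0) (h : z ≠ l) :
    logDeriv (sigmaFactor l) z = (z - l)⁻¹ + l⁻¹ + z / l ^ 2 := by
  have h1 : HasDerivAt (fun z : ℂ ↦ 1 - z / l) (-(1 / l)) z :=
    ((hasDerivAt_id z).div_const l).const_sub 1
  have h2 : HasDerivAt (fun z : ℂ ↦ z / l + z ^ 2 / (2 * l ^ 2)) (1 / l + z / l ^ 2) z := by
    convert! ((hasDerivAt_id z).div_const l).add ((hasDerivAt_pow 2 z).div_const (2 * l ^ 2)) using 1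
    simp
    field_simp
  have h3 := h1.mul h2.cexp
  have h4 : z - l ≠ 0 := sub_ne_zero.mpr h
  have h5 : l - z ≠ 0 := sub_ne_zero.mpr h.symm
  have h6 := Complex.exp_ne_zero (z / l + z ^ 2 / (2 * l ^ 2))
  have h7 : 1 - z / l ≠ 0 := by
    rw [one_sub_div hl]; positivity
  rw [logDeriv_apply, show deriv (sigmaFactor l) z = _ from h3.deriv, sigmaFactor,
    div_eq_iff (mul_ne_zero h7 h6)]
  field_simp
  ring

lemma norm_sigmaFactor_sub_one_le {r : ℝ} {l z : ℂ} (hz : ‖z‖ < r) (hl : 2 * r ≤ ‖l‖) :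
    ‖sigmaFactor l z - 1‖ ≤ 2 * r ^ 3 * (‖l‖ ^ 3)⁻¹ := by
  have hr : 0 < r := (norm_nonneg z).trans_lt hz
  have hl0 : 0 < ‖l‖ := by linarith
  have ht : ‖z / l‖ ≤ 1 / 2 := by
    rw [norm_div, div_le_iff₀ hl0]; linarith
  have h := norm_one_sub_mul_exp_sub_one_le ht
  rw [show z / l + (z / l) ^ 2 / 2 = z / l + z ^ 2 / (2 * l ^ 2) by
    rw [div_pow, div_div, mul_comm (l ^ 2)]] at h
  refine h.trans ?_
  rw [norm_div, div_pow, mul_assoc, div_eq_mul_inv]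
  gcongr

lemma eventually_cofinite_le_norm (R : ℝ) : ∀ᶠ l : L.lattice in cofinite, R ≤ ‖l.1‖ := by
  refine (isCompact_iff_finite.mp (isCompact_closedBall (0 : L.lattice) R)).subset fun l hl ↦ ?_
  simpa using (not_le.mp (by simpa using hl : ¬R ≤ ‖l.1‖)).le

lemma multipliableLocallyUniformlyOn_sigmaFactor (r : ℝ) :
    MultipliableLocallyUniformlyOn (fun (l : L.lattice) z ↦ sigmaFactor l z) (Metric.ball 0 r) := by
  have := Summable.multipliableLocallyUniformlyOn_one_add (K := Metric.ball (0 : ℂ) r)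
    (f := fun (l : L.lattice) z ↦ sigmaFactor l z - 1) Metric.isOpen_ball
    (L.summable_norm_inv_pow_three.mul_left (2 * r ^ 3)) ?_ fun l ↦ ?_
  · simpa using this
  · filter_upwards [L.eventually_cofinite_le_norm (2 * r)] with l hl z hz
    exact norm_sigmaFactor_sub_one_le (by simpa using hz) hl
  · exact ((differentiable_sigmaFactor l).continuous.sub continuous_const).continuousOn

/-- The product part of the sigma function. -/
noncomputable def sigmaProd (z : ℂ) : ℂ := ∏' l : L.lattice, sigmaFactor l z

@[fun_prop]
lemma differentiable_sigmaProd : Differentiable ℂ L.sigmaProd := fun z ↦ by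
  have h := (L.multipliableLocallyUniformlyOn_sigmaFactor (‖z‖ + 1)).hasProdLocallyUniformlyOn
  have hd : DifferentiableOn ℂ L.sigmaProd (Metric.ball 0 (‖z‖ + 1)) :=
    h.differentiableOn (.of_forall fun s ↦ .fun_finsetProd fun i _ ↦
      (differentiable_sigmaFactor _).differentiableOn) Metric.isOpen_ball
  exact hd.differentiableAt (Metric.isOpen_ball.mem_nhds (by simp))

@[simp] lemma sigmaProd_zero : L.sigmaProd 0 = 1 := by simp [sigmaProd]

lemma sigmaProd_neg (z : ℂ) : L.sigmaProd (-z) = L.sigmaProd z := by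
  rw [sigmaProd, ← (Equiv.neg L.lattice).tprod_eq]
  simp [sigmaFactor_neg, sigmaProd]

lemma sigmaProd_ne_zero {z : ℂ} (hz : z ∉ L.lattice) : L.sigmaProd z ≠ 0 := by
  have := tprod_one_add_ne_zero_of_summable (f := fun l : L.lattice ↦ sigmaFactor l z - 1)
    (fun l ↦ by simpa using sigmaFactor_ne_zero (by rintro rfl; exact hz l.2)) ?_
  · simpa [sigmaProd] using this
  · refine .of_norm_bounded_eventually (L.summable_norm_inv_pow_three.mul_left
      (2 * (‖z‖ + 1) ^ 3)) ?_
    filter_upwards [L.eventually_cofinite_le_norm (2 * (‖z‖ + 1))] with l hl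
    simpa using norm_sigmaFactor_sub_one_le (lt_add_one _) hl

/-- The summand attached to a lattice point in the series for the zeta function. -/
noncomputable def zetaSummand (l z : ℂ) : ℂ := (z - l)⁻¹ + l⁻¹ + z / l ^ 2

lemma norm_zetaSummand_le {r : ℝ} {l z : ℂ} (hz : ‖z‖ < r) (hl : 2 * r ≤ ‖l‖) :
    ‖zetaSummand l z‖ ≤ 2 * r ^ 2 * (‖l‖ ^ 3)⁻¹ := by
  have hr : 0 < r := (norm_nonneg z).trans_lt hz
  have hl0 : 0 < ‖l‖ := by linarith
  have hl' : l ≠ 0 := norm_pos_iff.mp hl0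
  have hd : ‖l‖ / 2 ≤ ‖z - l‖ := by
    rw [norm_sub_rev]; exact .trans (by linarith) (norm_sub_norm_le l z)
  have hzl : z - l ≠ 0 := norm_pos_iff.mp (by linarith)
  have : zetaSummand l z = z ^ 2 / (l ^ 2 * (z - l)) := by
    rw [zetaSummand]; field_simp; ring
  rw [this, norm_div, norm_mul, norm_pow, norm_pow]
  calc _ ≤ r ^ 2 / (‖l‖ ^ 2 * (‖l‖ / 2)) := by gcongr
    _ = _ := by field_simp

/-- The Weierstrass zeta function of the period lattice. -/
noncomputable def zeta (z : ℂ) : ℂ := ∑' l : L.lattice, zetaSummand l z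

lemma hasSumLocallyUniformly_zeta :
    HasSumLocallyUniformly (fun (l : L.lattice) z ↦ zetaSummand l z) L.zeta := by
  refine L.hasSumLocallyUniformly_aux (u := fun r l ↦ 2 * r ^ 2 * (‖l.1‖ ^ 3)⁻¹) _
    (fun _ _ ↦ L.summable_norm_inv_pow_three.mul_left _) fun r hr ↦
    eventually_atTop.mpr ⟨2 * r, ?_⟩
  rintro _ h s hs l rfl
  exact norm_zetaSummand_le hs h

lemma hasSum_zeta (z : ℂ) : HasSum (fun l : L.lattice ↦ zetaSummand l z) (L.zeta z) :=
  L.hasSumLocallyUniformly_zeta.hasSum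

lemma hasDerivAt_zetaSummand {l z : ℂ} (h : z ≠ l) :
    HasDerivAt (zetaSummand l) (-(1 / (z - l) ^ 2 - 1 / l ^ 2)) z := by
  have h1 := (((hasDerivAt_id z).sub_const l).inv (sub_ne_zero.mpr h)).add_const l⁻¹
  convert! h1.add ((hasDerivAt_id z).div_const (l ^ 2)) using 1
  simp
  ring

lemma differentiableOn_zetaSummand (l : L.lattice) :
    DifferentiableOn ℂ (zetaSummand l) (L.lattice : Set ℂ)ᶜ := fun z hz ↦
  (hasDerivAt_zetaSummand (by rintro rfl; exact hz l.2)).differentiableAt.differentiableWithinAt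

lemma hasDerivAt_zeta {z : ℂ} (hz : z ∉ L.lattice) :
    HasDerivAt L.zeta (-L.weierstrassP z) z := by
  have hu := L.hasSumLocallyUniformly_zeta.hasSumLocallyUniformlyOn (s := (L.lattice : Set ℂ)ᶜ)
  have hs : ∀ s : Finset L.lattice,
      DifferentiableOn ℂ (fun z ↦ ∑ l ∈ s, zetaSummand l z) (L.lattice : Set ℂ)ᶜ := fun s ↦
    .fun_sum fun l _ ↦ L.differentiableOn_zetaSummand l
  have hd := (hu.differentiableOn (.of_forall hs) L.isOpen_compl_lattice).differentiableAt
    (L.isOpen_compl_lattice.mem_nhds hz)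
  have h1 := (TendstoLocallyUniformlyOn.deriv hu (.of_forall hs)
    L.isOpen_compl_lattice).tendsto_at hz
  have h2 : Tendsto (fun s : Finset L.lattice ↦ ∑ l ∈ s, -(1 / (z - l) ^ 2 - 1 / (l : ℂ) ^ 2))
    atTop (𝓝 (-L.weierstrassP z)) := (L.hasSum_weierstrassP z).neg
  rw [tendsto_nhds_unique (h2.congr fun s ↦ ?_) h1]
  · exact hd.hasDerivAt
  · exact (HasDerivAt.fun_sum fun (l : L.lattice) _ ↦
      hasDerivAt_zetaSummand (l := l) (z := z) (by rintro rfl; exact hz l.2)).deriv.symm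

/-- The Weierstrass sigma function of the period lattice. -/
noncomputable def sigma (z : ℂ) : ℂ := z * L.sigmaProd z

@[fun_prop]
lemma differentiable_sigma : Differentiable ℂ L.sigma := by
  unfold sigma
  fun_prop

lemma sigma_neg (z : ℂ) : L.sigma (-z) = -L.sigma z := by simp [sigma, sigmaProd_neg]

@[simp] lemma sigma_zero : L.sigma 0 = 0 := by simp [sigma]

lemma sigma_ne_zero {z : ℂ} (hz : z ∉ L.lattice) : L.sigma z ≠ 0 :=
  mul_ne_zero (by rintro rfl; exact hz (zero_mem _)) (L.sigmaProd_ne_zero hz)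

lemma deriv_sigma_zero : deriv L.sigma 0 = 1 := by
  have := (hasDerivAt_id (0 : ℂ)).mul (L.differentiable_sigmaProd 0).hasDerivAt
  exact this.deriv.trans (by simp)

lemma logDeriv_sigmaProd {z : ℂ} (hz : z ∉ L.lattice) :
    logDeriv L.sigmaProd z = L.zeta z - z⁻¹ := by
  have hs : HasSum (fun l : L.lattice ↦ logDeriv (sigmaFactor l) z) (L.zeta z - z⁻¹) := by
    have h0 := hasSum_ite_eq (0 : L.lattice) z⁻¹
    refine ((L.hasSum_zeta z).sub h0).congr_fun fun l ↦ ?_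
    split_ifs with hl
    · subst hl
      simp [zetaSummand, show sigmaFactor 0 = fun _ ↦ 1 from funext sigmaFactor_zero_left]
    · rw [logDeriv_sigmaFactor (by simpa using hl) (by rintro rfl; exact hz l.2), zetaSummand,
        sub_zero]
  rw [← hs.tsum_eq]
  exact logDeriv_tprod_eq_tsum Metric.isOpen_ball (x := z) (s := Metric.ball 0 (‖z‖ + 1))
    (by simp) (fun l ↦ sigmaFactor_ne_zero (by rintro rfl; exact hz l.2))
    (fun l ↦ (differentiable_sigmaFactor _).differentiableOn) hs.summable
    (L.multipliableLocallyUniformlyOn_sigmaFactor _) (L.sigmaProd_ne_zero hz)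

lemma hasDerivAt_sigma {z : ℂ} (hz : z ∉ L.lattice) :
    HasDerivAt L.sigma (L.sigma z * L.zeta z) z := by
  have h := (hasDerivAt_id z).mul (L.differentiable_sigmaProd z).hasDerivAt
  have h0 : z ≠ 0 := by rintro rfl; exact hz (zero_mem _)
  have h1 := L.logDeriv_sigmaProd hz
  rw [logDeriv_apply, div_eq_iff (L.sigmaProd_ne_zero hz)] at h1
  convert! h using 1
  rw [h1, sigma]
  simp
  field_simp
  ring

lemma add_coe_mem_compl {z : ℂ} (hz : z ∉ L.lattice) (w : L.lattice) : z + w ∉ L.lattice := fun h ↦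
  hz (by simpa using sub_mem h w.2)

lemma exists_zeta_add_coe (w : L.lattice) :
    ∃ η : ℂ, ∀ z ∉ L.lattice, L.zeta (z + w) = L.zeta z + η := by
  have hd : ∀ z ∉ L.lattice, HasDerivAt (fun z ↦ L.zeta (z + w) - L.zeta z) 0 z := fun z hz ↦ by
    have h := ((L.hasDerivAt_zeta (L.add_coe_mem_compl hz w)).comp_add_const z w).sub
      (L.hasDerivAt_zeta hz)
    rw [weierstrassP_add_coe, sub_self] at h
    exact h
  obtain ⟨η, h⟩ := L.isOpen_compl_lattice.exists_is_const_of_deriv_eq_zero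
    L.isPreconnected_compl_lattice
    (fun z hz ↦ (hd z hz).differentiableAt.differentiableWithinAt) (fun z hz ↦ (hd z hz).deriv)
  exact ⟨η, fun z hz ↦ by linear_combination h z hz⟩

lemma sigma_eq_zero_of_mem {z : ℂ} (hz : z ∈ L.lattice) : L.sigma z = 0 := by
  rcases eq_or_ne z 0 with rfl | h0
  · simp
  · have h : sigmaFactor z z = 0 := by simp [sigmaFactor, h0]
    rw [sigma, sigmaProd, tprod_of_exists_eq_zero ⟨⟨z, hz⟩, h⟩, mul_zero]

/-- The sigma function is quasi-periodic. -/
lemma exists_sigma_add_coe (w : L.lattice) :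
    ∃ C η : ℂ, C ≠ 0 ∧ ∀ z, L.sigma (z + w) = C * Complex.exp (η * z) * L.sigma z := by
  obtain ⟨η, hη⟩ := L.exists_zeta_add_coe w
  have hd : ∀ z ∉ L.lattice,
      HasDerivAt (fun z ↦ L.sigma (z + w) * Complex.exp (-(η * z)) / L.sigma z) 0 z := fun z hz ↦ by
    have hs := L.sigma_ne_zero hz
    have h1 := (L.hasDerivAt_sigma (L.add_coe_mem_compl hz w)).comp_add_const z w
    have h2 := ((hasDerivAt_id z).const_mul η).neg.cexp
    convert! (h1.mul h2).div (L.hasDerivAt_sigma hz) hs using 1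
    rw [hη z hz, eq_div_iff (pow_ne_zero 2 hs)]
    simp
    ring
  obtain ⟨C, h⟩ := L.isOpen_compl_lattice.exists_is_const_of_deriv_eq_zero
    L.isPreconnected_compl_lattice
    (fun z hz ↦ (hd z hz).differentiableAt.differentiableWithinAt) (fun z hz ↦ (hd z hz).deriv)
  refine ⟨C, η, ?_, fun z ↦ ?_⟩
  · have hz := L.ω₁_div_two_notMem_lattice
    rw [← h _ hz]
    exact div_ne_zero (mul_ne_zero (L.sigma_ne_zero (L.add_coe_mem_compl hz w))
      (Complex.exp_ne_zero _)) (L.sigma_ne_zero hz)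
  · by_cases hz : z ∈ L.lattice
    · rw [L.sigma_eq_zero_of_mem hz, L.sigma_eq_zero_of_mem (add_mem hz w.2), mul_zero]
    · have h' := h z hz
      rw [div_eq_iff (L.sigma_ne_zero hz), Complex.exp_neg] at h'
      have := Complex.exp_ne_zero (η * z)
      field_simp at h'
      rw [h', mul_comm η]
      ring

/-- The entire function equal to `σ ^ 2 * ℘` away from the lattice. -/
noncomputable def sigmaSqMulP (z : ℂ) : ℂ :=
  deriv L.sigma z ^ 2 - L.sigma z * deriv (deriv L.sigma) z

@[fun_prop]
lemma differentiable_deriv_sigma : Differentiable ℂ (deriv L.sigma) :=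
  L.differentiable_sigma.deriv

@[fun_prop]
lemma differentiable_sigmaSqMulP : Differentiable ℂ L.sigmaSqMulP := by
  have : Differentiable ℂ (deriv (deriv L.sigma)) := L.differentiable_deriv_sigma.deriv
  unfold sigmaSqMulP
  fun_prop

lemma sigmaSqMulP_eq {z : ℂ} (hz : z ∉ L.lattice) :
    L.sigmaSqMulP z = L.sigma z ^ 2 * L.weierstrassP z := by
  have h : deriv L.sigma =ᶠ[𝓝 z] fun z ↦ L.sigma z * L.zeta z := by
    filter_upwards [L.isOpen_compl_lattice.mem_nhds hz] with x hx
    exact (L.hasDerivAt_sigma hx).deriv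
  have h2 := ((L.hasDerivAt_sigma hz).mul (L.hasDerivAt_zeta hz)).deriv
  rw [sigmaSqMulP, h.deriv_eq, (L.hasDerivAt_sigma hz).deriv]
  change deriv (fun z ↦ L.sigma z * L.zeta z) z = _ at h2
  rw [h2]
  ring

lemma deriv_sigma_neg (z : ℂ) : deriv L.sigma (-z) = deriv L.sigma z := by
  have h := deriv_comp_neg L.sigma z
  rw [show (fun x ↦ L.sigma (-x)) = fun x ↦ -L.sigma x from funext L.sigma_neg,
    deriv.fun_neg] at h
  linear_combination h

lemma sigmaSqMulP_neg (z : ℂ) : L.sigmaSqMulP (-z) = L.sigmaSqMulP z := by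
  have h := deriv_comp_neg (deriv L.sigma) z
  rw [show (fun x ↦ deriv L.sigma (-x)) = deriv L.sigma from funext L.deriv_sigma_neg] at h
  rw [sigmaSqMulP, sigmaSqMulP, sigma_neg, deriv_sigma_neg, h]
  ring

@[simp] lemma sigmaSqMulP_zero : L.sigmaSqMulP 0 = 1 := by simp [sigmaSqMulP, deriv_sigma_zero]

/-- `σ` and `σ ^ 2 * ℘` have compatible factors of quasi-periodicity. -/
lemma exists_sigma_sigmaSqMulP_add_coe (w : L.lattice) :
    ∃ C η : ℂ, C ≠ 0 ∧ ∀ z, L.sigma (z + w) = C * Complex.exp (η * z) * L.sigma z ∧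
      L.sigmaSqMulP (z + w) = (C * Complex.exp (η * z)) ^ 2 * L.sigmaSqMulP z := by
  obtain ⟨C, η, hC, h⟩ := L.exists_sigma_add_coe w
  refine ⟨C, η, hC, fun z ↦ ⟨h z, ?_⟩⟩
  have he (z : ℂ) : HasDerivAt (fun z ↦ C * Complex.exp (η * z)) (C * Complex.exp (η * z) * η) z := by
    convert! ((hasDerivAt_id z).const_mul η).cexp.const_mul C using 1
    simp
    ring
  have h1 (z : ℂ) : deriv L.sigma (z + w) =
      C * Complex.exp (η * z) * (η * L.sigma z + deriv L.sigma z) := by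
    rw [← deriv_comp_add_const, funext h]
    refine ((he z).mul (L.differentiable_sigma z).hasDerivAt).deriv.trans ?_
    ring
  have h2 : deriv (deriv L.sigma) (z + w) = C * Complex.exp (η * z) *
      (η ^ 2 * L.sigma z + 2 * η * deriv L.sigma z + deriv (deriv L.sigma) z) := by
    rw [← deriv_comp_add_const, funext h1]
    refine ((he z).mul (((L.differentiable_sigma z).hasDerivAt.const_mul η).add
      (L.differentiable_deriv_sigma z).hasDerivAt)).deriv.trans ?_
    simp
    ring
  rw [sigmaSqMulP, sigmaSqMulP, h, h1, h2]
  ring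

/-- An even entire function `N` vanishing at the origin is a multiple of `z ^ 2`. -/
lemma exists_eq_sq_mul_of_even {N : ℂ → ℂ} (hN : Differentiable ℂ N) (he : ∀ z, N (-z) = N z)
    (h0 : N 0 = 0) : ∃ n : ℂ → ℂ, Differentiable ℂ n ∧ ∀ z, N z = z ^ 2 * n z := by
  have hd : deriv N 0 = 0 := by
    have h := deriv_comp_neg N 0
    rw [funext he, neg_zero] at h
    exact CharZero.eq_neg_self_iff.mp h
  have diff {f : ℂ → ℂ} (hf : Differentiable ℂ f) : Differentiable ℂ (dslope f 0) := by
    rw [← differentiableOn_univ] at hf ⊢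
    exact (Complex.differentiableOn_dslope univ_mem).mpr hf
  refine ⟨dslope (dslope N 0) 0, diff (diff hN), fun z ↦ ?_⟩
  have h1 := sub_smul_dslope (dslope N 0) 0 z
  have h2 := sub_smul_dslope N 0 z
  rw [dslope_same, hd] at h1
  rw [h0] at h2
  simp only [sub_zero, smul_eq_mul] at h1 h2
  linear_combination -h2 - z * h1

/-- The difference of the two sides of `sigma_add_mul_sigma_sub`. -/
noncomputable def sigmaRelation (c z : ℂ) : ℂ :=
  L.sigma (z + c) * L.sigma (z - c) -
    (L.sigma z ^ 2 * L.sigmaSqMulP c - L.sigmaSqMulP z * L.sigma c ^ 2)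

lemma sigmaRelation_add_coe (c : ℂ) (w : L.lattice) :
    ∃ g : ℂ → ℂ, (∀ z, g z ≠ 0) ∧ ∀ z, L.sigma (z + w) = g z * L.sigma z ∧
      L.sigmaRelation c (z + w) = g z ^ 2 * L.sigmaRelation c z := by
  obtain ⟨C, η, hC, h⟩ := L.exists_sigma_sigmaSqMulP_add_coe w
  refine ⟨fun z ↦ C * Complex.exp (η * z), fun z ↦ mul_ne_zero hC (Complex.exp_ne_zero _),
    fun z ↦ ⟨(h z).1, ?_⟩⟩
  have e : Complex.exp (η * (z + c)) * Complex.exp (η * (z - c)) = Complex.exp (η * z) ^ 2 := by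
    rw [← Complex.exp_add, ← Complex.exp_nat_mul]
    congr 1
    push_cast
    ring
  rw [sigmaRelation, sigmaRelation, add_right_comm, add_sub_right_comm, (h _).1, (h _).1, (h _).1,
    (h _).2]
  linear_combination C ^ 2 * L.sigma (z + c) * L.sigma (z - c) * e

lemma differentiable_sigmaRelation (c : ℂ) : Differentiable ℂ (L.sigmaRelation c) := by
  unfold sigmaRelation
  fun_prop

lemma sigmaRelation_zero (c : ℂ) : L.sigmaRelation c 0 = 0 := by
  simp [sigmaRelation, sigma_neg]
  ring

lemma sigmaRelation_neg (c z : ℂ) : L.sigmaRelation c (-z) = L.sigmaRelation c z := by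
  rw [sigmaRelation, sigmaRelation, show -z + c = -(z - c) by ring,
    show -z - c = -(z + c) by ring]
  simp only [sigma_neg, sigmaSqMulP_neg]
  ring

lemma sigmaRelation_eq_zero_of_notMem {c z : ℂ} (hc : c ∉ L.lattice) (hz : z ∉ L.lattice) :
    L.sigmaRelation c z = 0 := by
  classical
  obtain ⟨n, hn, hN⟩ := exists_eq_sq_mul_of_even (L.differentiable_sigmaRelation c)
    (L.sigmaRelation_neg c) (L.sigmaRelation_zero c)
  let Q : ℂ → ℂ := fun z ↦
    if z ∈ L.lattice then n 0 else L.sigmaRelation c z / L.sigma z ^ 2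
  have hQ0 : Q =ᶠ[𝓝 0] fun z ↦ n z / L.sigmaProd z ^ 2 := by
    filter_upwards [L.compl_lattice_sdiff_singleton_mem_nhds 0] with z hz
    rcases eq_or_ne z 0 with rfl | h0
    · simp [Q]
    · have hz' : z ∉ L.lattice := fun h ↦ hz ⟨h, h0⟩
      simp only [Q, if_neg hz', hN, sigma, mul_pow]
      rw [mul_div_mul_left _ _ (pow_ne_zero 2 h0)]
  have hQp : ∀ z w, w ∈ L.lattice → Q (z + w) = Q z := fun z w hw ↦ by
    have hm : z + w ∈ L.lattice ↔ z ∈ L.lattice := L.lattice.add_mem_iff_left hw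
    obtain ⟨g, hg, h⟩ := L.sigmaRelation_add_coe c ⟨w, hw⟩
    simp only [Q, hm, (h z).1, (h z).2, mul_pow]
    rw [mul_div_mul_left _ _ (pow_ne_zero 2 (hg z))]
  have hQd0 : DifferentiableAt ℂ Q 0 := by
    refine DifferentiableAt.congr_of_eventuallyEq ?_ hQ0
    exact (hn 0).fun_div ((L.differentiable_sigmaProd 0).pow 2) (by simp)
  have hQd : Differentiable ℂ Q := fun z ↦ by
    by_cases hz : z ∈ L.lattice
    · have : Q = fun x ↦ Q (x + -z) := funext fun x ↦ (hQp x _ (neg_mem hz)).symm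
      rw [this, differentiableAt_comp_add_const]
      simpa using hQd0
    · have : Q =ᶠ[𝓝 z] fun z ↦ L.sigmaRelation c z / L.sigma z ^ 2 := by
        filter_upwards [L.isOpen_compl_lattice.mem_nhds hz] with x hx
        exact if_neg hx
      refine DifferentiableAt.congr_of_eventuallyEq ?_ this
      exact (L.differentiable_sigmaRelation c z).fun_div ((L.differentiable_sigma z).pow 2)
        (pow_ne_zero 2 (L.sigma_ne_zero hz))
  have hconst := hQd.apply_eq_apply_of_bounded
    (IsZLattice.isCompact_range_of_periodic L.lattice Q hQd.continuous hQp).isBounded z c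
  have hc0 : L.sigmaRelation c c = 0 := by simp [sigmaRelation]; ring
  simp only [Q, if_neg hz, if_neg hc, hc0, zero_div] at hconst
  exact (div_eq_zero_iff.mp hconst).resolve_right (pow_ne_zero 2 (L.sigma_ne_zero hz))

/-- The multiplicative form of `℘ c - ℘ z = σ (z + c) * σ (z - c) / (σ z ^ 2 * σ c ^ 2)`. -/
theorem sigma_add_mul_sigma_sub (z c : ℂ) :
    L.sigma (z + c) * L.sigma (z - c) =
      L.sigma z ^ 2 * L.sigmaSqMulP c - L.sigmaSqMulP z * L.sigma c ^ 2 := by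
  have hmem {z : ℂ} (c : ℂ) (hz : z ∈ L.lattice) : L.sigmaRelation c z = 0 := by
    obtain ⟨g, -, h⟩ := L.sigmaRelation_add_coe c ⟨z, hz⟩
    simpa [sigmaRelation_zero] using (h 0).2
  have hswap : L.sigmaRelation c z = -L.sigmaRelation z c := by
    rw [sigmaRelation, sigmaRelation, ← neg_sub z c, sigma_neg, add_comm c z]
    ring
  rw [← sub_eq_zero]
  change L.sigmaRelation c z = 0
  by_cases hz : z ∈ L.lattice
  · exact hmem c hz
  by_cases hc : c ∈ L.lattice
  · rw [hswap, hmem z hc, neg_zero]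
  · exact L.sigmaRelation_eq_zero_of_notMem hc hz

/-- The derivative of `sigma_add_mul_sigma_sub` in the first variable. -/
lemma deriv_sigma_add_mul_sigma_sub (z c : ℂ) :
    deriv L.sigma (z + c) * L.sigma (z - c) + L.sigma (z + c) * deriv L.sigma (z - c) =
      2 * L.sigma z * deriv L.sigma z * L.sigmaSqMulP c -
        deriv L.sigmaSqMulP z * L.sigma c ^ 2 := by
  have hs (z : ℂ) := (L.differentiable_sigma z).hasDerivAt
  have h1 := ((hs (z + c)).comp_add_const z c).mul ((hs (z - c)).comp_sub_const z c)
  have h2 := (((hs z).pow 2).mul_const (L.sigmaSqMulP c)).sub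
    ((L.differentiable_sigmaSqMulP z).hasDerivAt.mul_const (L.sigma c ^ 2))
  have h : (fun z ↦ L.sigma (z + c) * L.sigma (z - c)) = fun z ↦
      L.sigma z ^ 2 * L.sigmaSqMulP c - L.sigmaSqMulP z * L.sigma c ^ 2 :=
    funext fun z ↦ L.sigma_add_mul_sigma_sub z c
  change HasDerivAt (fun z ↦ L.sigma (z + c) * L.sigma (z - c)) _ z at h1
  rw [h] at h1
  rw [h1.unique h2]
  simp

/-- The duplication formula for the sigma function. -/
lemma sigma_two_mul (z : ℂ) :
    L.sigma (z + z) = 2 * L.sigma z * deriv L.sigma z * L.sigmaSqMulP z -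
      deriv L.sigmaSqMulP z * L.sigma z ^ 2 := by
  simpa [deriv_sigma_zero] using L.deriv_sigma_add_mul_sigma_sub z z

/-- The four-point relation expressing `ζ (u - x) + ζ x - ζ (u - y) - ζ y` through `σ`, cleared of
denominators. -/
theorem sigma_mul_deriv_sigma_sub (u x y : ℂ) :
    (deriv L.sigma (u - x) * L.sigma x + L.sigma (u - x) * deriv L.sigma x) *
        (L.sigma (u - y) * L.sigma y) -
      (deriv L.sigma (u - y) * L.sigma y + L.sigma (u - y) * deriv L.sigma y) *
        (L.sigma (u - x) * L.sigma x) =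
      -(L.sigma u * L.sigma (u - x - y) * L.sigma (x - y)) := by
  have e1 (x : ℂ) : u / 2 + (u / 2 - x) = u - x := by ring
  have e2 (x : ℂ) : u / 2 - (u / 2 - x) = x := by ring
  have hx := L.sigma_add_mul_sigma_sub (u / 2) (u / 2 - x)
  have hy := L.sigma_add_mul_sigma_sub (u / 2) (u / 2 - y)
  have dx := L.deriv_sigma_add_mul_sigma_sub (u / 2) (u / 2 - x)
  have dy := L.deriv_sigma_add_mul_sigma_sub (u / 2) (u / 2 - y)
  have h2 := L.sigma_two_mul (u / 2)
  have hb := L.sigma_add_mul_sigma_sub (u / 2 - x) (u / 2 - y)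
  rw [show u / 2 - x + (u / 2 - y) = u - x - y by ring,
    show u / 2 - x - (u / 2 - y) = -(x - y) by ring, sigma_neg] at hb
  rw [e1, e2] at hx hy dx dy
  rw [add_halves] at h2
  rw [hx, hy, dx, dy, h2]
  linear_combination (deriv L.sigmaSqMulP (u / 2) * L.sigma (u / 2) ^ 2 -
      2 * L.sigma (u / 2) * deriv L.sigma (u / 2) * L.sigmaSqMulP (u / 2)) * hb

end PeriodPair

lemma mem_wLattice_iff (L : PeriodPair) {z : ℂ} : z ∈ wLattice L.ω₁ L.ω₂ ↔ z ∈ L.lattice := by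
  rw [wLattice, PeriodPair.lattice, ← Submodule.mem_toAddSubgroup,
    Submodule.span_int_eq_addSubgroupClosure]

/-- The inclusion of the nonzero periods in the lattice. -/
def wLatticeStar.toLattice (L : PeriodPair) (w : wLatticeStar L.ω₁ L.ω₂) : L.lattice :=
  ⟨w.1, (mem_wLattice_iff L).mp w.2.1⟩

lemma wLatticeStar.toLattice_injective (L : PeriodPair) :
    Function.Injective (wLatticeStar.toLattice L) := fun _ _ h ↦
  Subtype.ext (congrArg (fun l : L.lattice ↦ (l : ℂ)) h)

lemma wLatticeStar.mem_range_toLattice (L : PeriodPair) {l : L.lattice} (hl : l ≠ 0) :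
    l ∈ Set.range (wLatticeStar.toLattice L) :=
  ⟨⟨l, (mem_wLattice_iff L).mpr l.2, by simpa using hl⟩, rfl⟩

lemma wSigma_eq_sigma (L : PeriodPair) : wSigma L.ω₁ L.ω₂ = L.sigma := by
  funext z
  rw [wSigma, PeriodPair.sigma, PeriodPair.sigmaProd,
    ← (wLatticeStar.toLattice_injective L).tprod_eq]
  · rfl
  · exact fun l hl ↦ wLatticeStar.mem_range_toLattice L (by rintro rfl; simp at hl)

lemma tsum_wLatticeStar (L : PeriodPair) {f : ℂ → ℂ} (hf : Summable fun l : L.lattice ↦ f l) :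
    f 0 + ∑' w : wLatticeStar L.ω₁ L.ω₂, f w.1 = ∑' l : L.lattice, f l := by
  classical
  rw [hf.tsum_eq_add_tsum_ite 0, ← (wLatticeStar.toLattice_injective L).tsum_eq]
  · congr 2 with w
    rw [if_neg fun h ↦ w.2.2 (congrArg Subtype.val h)]
    rfl
  · exact fun l hl ↦ wLatticeStar.mem_range_toLattice L (by rintro rfl; simp at hl)

lemma wZeta_eq_zeta (L : PeriodPair) : wZeta L.ω₁ L.ω₂ = L.zeta := by
  funext z
  rw [wZeta, PeriodPair.zeta,
    ← tsum_wLatticeStar L (f := fun l ↦ PeriodPair.zetaSummand l z) (L.hasSum_zeta z).summable]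
  simp [PeriodPair.zetaSummand]

lemma wP_eq_weierstrassP (L : PeriodPair) : wP L.ω₁ L.ω₂ = L.weierstrassP := by
  funext z
  rw [wP, PeriodPair.weierstrassP,
    ← tsum_wLatticeStar L (f := fun l ↦ 1 / (z - l) ^ 2 - 1 / l ^ 2)
      (L.hasSum_weierstrassP z).summable]
  simp

lemma deriv_cmF (L : PeriodPair) {u x : ℂ} (hu : u ∉ L.lattice) (hx : x ∉ L.lattice) :
    deriv (cmF L.ω₁ L.ω₂ u) x = Complex.exp (L.zeta u * x) *
      (L.zeta u * L.sigma (u - x) * L.sigma x -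
        (deriv L.sigma (u - x) * L.sigma x + L.sigma (u - x) * deriv L.sigma x)) /
      (L.sigma u * L.sigma x ^ 2) := by
  have hσu := L.sigma_ne_zero hu
  have hσx := L.sigma_ne_zero hx
  have hs (z : ℂ) := (L.differentiable_sigma z).hasDerivAt
  have h1 := ((hs (u - x)).comp_const_sub u x).mul ((hasDerivAt_id x).const_mul (L.zeta u)).cexp
  have h2 := h1.div ((hs x).const_mul (L.sigma u)) (mul_ne_zero hσu hσx)
  have h3 : cmF L.ω₁ L.ω₂ u = fun x ↦ L.sigma (u - x) * Complex.exp (L.zeta u * x) /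
      (L.sigma u * L.sigma x) := by
    funext x
    rw [cmF, wSigma_eq_sigma, wZeta_eq_zeta]
  rw [h3]
  refine h2.deriv.trans ?_
  simp
  field_simp
  ring

/-- The addition formula `f(x) f'(y) - f(y) f'(x) = (z(x) - z(y)) f(x+y)` with
`z(x) = ℘(x) + ℘(u)/2` (taking `λ = 1`). -/
theorem cmF_addition_formula (ω₁ ω₂ u x y : ℂ)
    (hω : LinearIndependent ℝ ![ω₁, ω₂])
    (hu : u ∉ wLattice ω₁ ω₂) (hx : x ∉ wLattice ω₁ ω₂) (hy : y ∉ wLattice ω₁ ω₂)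
    (hxy : x + y ∉ wLattice ω₁ ω₂)
    (hux : u - x ∉ wLattice ω₁ ω₂) (huy : u - y ∉ wLattice ω₁ ω₂)
    (huxy : u - x - y ∉ wLattice ω₁ ω₂) :
    cmF ω₁ ω₂ u x * deriv (cmF ω₁ ω₂ u) y - cmF ω₁ ω₂ u y * deriv (cmF ω₁ ω₂ u) x =
      ((wP ω₁ ω₂ x + wP ω₁ ω₂ u / 2) - (wP ω₁ ω₂ y + wP ω₁ ω₂ u / 2)) *
        cmF ω₁ ω₂ u (x + y) := by
  let L : PeriodPair := ⟨ω₁, ω₂, hω⟩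
  have hL (z : ℂ) : z ∈ wLattice ω₁ ω₂ ↔ z ∈ L.lattice := mem_wLattice_iff L
  rw [hL] at hu hx hy hxy huxy
  have hσu := L.sigma_ne_zero hu
  have hσx := L.sigma_ne_zero hx
  have hσy := L.sigma_ne_zero hy
  have hσxy := L.sigma_ne_zero hxy
  have key := L.sigma_mul_deriv_sigma_sub u x y
  have hP := L.sigma_add_mul_sigma_sub x y
  rw [L.sigmaSqMulP_eq hx, L.sigmaSqMulP_eq hy] at hP
  have hexp : Complex.exp (L.zeta u * (x + y)) =
      Complex.exp (L.zeta u * x) * Complex.exp (L.zeta u * y) := by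
    rw [mul_add, Complex.exp_add]
  have dx : deriv (cmF ω₁ ω₂ u) x = _ := deriv_cmF L hu hx
  have dy : deriv (cmF ω₁ ω₂ u) y = _ := deriv_cmF L hu hy
  have hσ : wSigma ω₁ ω₂ = L.sigma := wSigma_eq_sigma L
  have hζ : wZeta ω₁ ω₂ = L.zeta := wZeta_eq_zeta L
  have h℘ : wP ω₁ ω₂ = L.weierstrassP := wP_eq_weierstrassP L
  have hdiff : L.weierstrassP x - L.weierstrassP y =
      -(L.sigma (x + y) * L.sigma (x - y)) / (L.sigma x ^ 2 * L.sigma y ^ 2) := by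
    rw [hP]
    field_simp
    ring
  have hlhs : cmF ω₁ ω₂ u x * deriv (cmF ω₁ ω₂ u) y - cmF ω₁ ω₂ u y * deriv (cmF ω₁ ω₂ u) x =
      Complex.exp (L.zeta u * x) * Complex.exp (L.zeta u * y) *
        -(L.sigma u * L.sigma (u - x - y) * L.sigma (x - y)) /
        (L.sigma u ^ 2 * L.sigma x ^ 2 * L.sigma y ^ 2) := by
    rw [dx, dy, ← key, cmF, cmF, hσ, hζ]
    field_simp
    ring
  rw [hlhs, add_sub_add_right_eq_sub, h℘, hdiff, cmF, hσ, hζ, hexp, ← sub_sub]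
  field_simp
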